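/- The set Γ of exchangeable probability measures on {0,1}^ℕ is a convex and compact (in the weak-* topology) subset of Δ({0,1}^ℕ), and Γ equals the closed convex hull of the set of i.i.d. probability measures on {0,1}^ℕ (the measures under which the coordinates are i.i.d. Bernoulli with some parameter q ∈ [0,1]). -/

import Mathlib

open MeasureTheory Filter

/-- The realization space Ω = {0,1}^ℕ. -/
abbrev Omega : Type := ℕ → Bool

/-- The cylinder set N(σ) of realizations extending the partial realization σ. -/
def cyl (σ : List Bool) : Set Omega := {x | ∀ i : Fin σ.length, x i.1 = σ.get i}

/-- μ is exchangeable: cylinder probabilities are invariant under permutations. -/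
def Exchangeable (μ : Measure Omega) : Prop :=
  ∀ (σ : List Bool) (π : Equiv.Perm (Fin σ.length)),
    μ (cyl σ) = μ (cyl (List.ofFn (fun i => σ.get (π i))))

/-- The paradigm Γ of exchangeable theories. -/
def ExchangeableParadigm : Set (ProbabilityMeasure Omega) :=
  {μ | Exchangeable (μ : Measure Omega)}

/-- ∏_{i<n} q^{s_i} (1-q)^{1-s_i} for the partial realization σ. -/
noncomputable def bern (σ : List Bool) (q : unitInterval) : ℝ :=
  ∏ i : Fin σ.length, (if σ.get i then (q : ℝ) else 1 - (q : ℝ))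

/-- The paradigm of all i.i.d. theories: coordinates are i.i.d. Bernoulli(q), q ∈ [0,1]. -/
noncomputable def IIDparadigm : Set (ProbabilityMeasure Omega) :=
  {μ | ∃ q : unitInterval, ∀ σ : List Bool,
    (μ : Measure Omega) (cyl σ) = ENNReal.ofReal (bern σ q)}

/-- The convex hull of the i.i.d. paradigm: finite convex combinations of i.i.d. theories. -/
noncomputable def IIDconvexHull : Set (ProbabilityMeasure Omega) :=
  {μ | ∃ n : ℕ, ∃ w : Fin n → ENNReal, ∃ ν : Fin n → ProbabilityMeasure Omega,
    (∀ i, ν i ∈ IIDparadigm) ∧ (∑ i, w i = 1) ∧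
    (μ : Measure Omega) = ∑ i, w i • (ν i : Measure Omega)}

open Topology ProbabilityTheory

/-- The cylinder of sequences whose first `n` coordinates are given by `s`. -/
def tupleCyl {n : ℕ} (s : Fin n → Bool) : Set Omega := {x | ∀ i : Fin n, x i = s i}

lemma cyl_ofFn {n : ℕ} (s : Fin n → Bool) : cyl (List.ofFn s) = tupleCyl s := by
  ext x
  constructor
  · intro h i
    simpa using h ⟨i, by simp⟩
  · intro h i
    simpa using h ⟨i, by simpa using i.2⟩

lemma cyl_eq_tupleCyl (σ : List Bool) : cyl σ = tupleCyl σ.get := rfl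

lemma bern_ofFn {n : ℕ} (s : Fin n → Bool) (q : unitInterval) :
    bern (List.ofFn s) q = ∏ i, (if s i then (q : ℝ) else 1 - (q : ℝ)) := by
  unfold bern
  refine Fintype.prod_equiv (finCongr (by simp)) _ _ fun i => ?_
  simp only [List.get_eq_getElem, List.getElem_ofFn]
  rfl

lemma bern_nonneg (σ : List Bool) (q : unitInterval) : 0 ≤ bern σ q := by
  refine Finset.prod_nonneg fun i _ => ?_
  split_ifs
  · exact q.2.1
  · linarith [q.2.2]

lemma exchangeable_iff (μ : Measure Omega) :
    Exchangeable μ ↔ ∀ (n : ℕ) (s : Fin n → Bool) (π : Equiv.Perm (Fin n)),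
      μ (tupleCyl s) = μ (tupleCyl (s ∘ π)) := by
  constructor
  · intro h n s
    obtain ⟨σ, hσ⟩ := List.equivSigmaTuple.surjective ⟨n, s⟩
    cases hσ
    intro π
    have := h σ π
    rwa [cyl_ofFn] at this
  · intro h σ π
    rw [cyl_ofFn]
    exact h _ _ π

lemma isClopen_tupleCyl {n : ℕ} (s : Fin n → Bool) : IsClopen (tupleCyl s) := by
  have : tupleCyl s = ⋂ i : Fin n, (fun x : Omega => x i) ⁻¹' {s i} := by
    ext x; simp [tupleCyl]
  rw [this]
  exact isClopen_iInter_of_finite fun i => (isClopen_discrete _).preimage (continuous_apply _)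

lemma measurableSet_tupleCyl {n : ℕ} (s : Fin n → Bool) : MeasurableSet (tupleCyl s) :=
  (isClopen_tupleCyl s).isOpen.measurableSet

lemma continuous_measure_tupleCyl {n : ℕ} (s : Fin n → Bool) :
    Continuous fun μ : ProbabilityMeasure Omega => μ (tupleCyl s) :=
  continuous_iff_continuousAt.2 fun _ =>
    ProbabilityMeasure.tendsto_measure_of_isClopen_of_tendsto tendsto_id (isClopen_tupleCyl s)

lemma piNat_cylinder_eq_tupleCyl (x : Omega) (n : ℕ) :
    PiNat.cylinder x n = tupleCyl fun i : Fin n => x i := by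
  ext y
  exact ⟨fun h i => h i i.2, fun h i hi => h ⟨i, hi⟩⟩

lemma isPiSystem_piNat_cylinder :
    IsPiSystem {s : Set Omega | ∃ x n, s = PiNat.cylinder x n} := by
  rintro _ ⟨x, m, rfl⟩ _ ⟨y, n, rfl⟩ ⟨z, hzx, hzy⟩
  refine ⟨z, max m n, ?_⟩
  rw [← PiNat.mem_cylinder_iff_eq.1 hzx, ← PiNat.mem_cylinder_iff_eq.1 hzy]
  ext w
  simp only [Set.mem_inter_iff, PiNat.mem_cylinder_iff, lt_max_iff]
  grind

lemma probabilityMeasure_ext_of_tupleCyl {μ ν : ProbabilityMeasure Omega}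
    (h : ∀ (n : ℕ) (s : Fin n → Bool), μ (tupleCyl s) = ν (tupleCyl s)) : μ = ν := by
  apply Subtype.ext
  change (μ : Measure Omega) = ν
  refine ext_of_generate_finite {s : Set Omega | ∃ x n, s = PiNat.cylinder x n} ?_
    isPiSystem_piNat_cylinder ?_ (by simp)
  · rw [← (PiNat.isTopologicalBasis_cylinders fun _ => Bool).borel_eq_generateFrom]
    exact BorelSpace.measurable_eq
  · rintro _ ⟨x, n, rfl⟩
    rw [piNat_cylinder_eq_tupleCyl]
    have := congrArg ((↑) : NNReal → ENNReal) (h n fun i => x i)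
    simpa using this

lemma isClosed_exchangeableParadigm : IsClosed ExchangeableParadigm := by
  have : ExchangeableParadigm = ⋂ (n : ℕ) (s : Fin n → Bool) (π : Equiv.Perm (Fin n)),
      {μ : ProbabilityMeasure Omega | μ (tupleCyl s) = μ (tupleCyl (s ∘ π))} := by
    ext μ
    simp only [ExchangeableParadigm, Set.mem_ofPred_eq, exchangeable_iff, Set.mem_iInter]
    simp only [← ProbabilityMeasure.ennreal_coeFn_eq_coeFn_toMeasure, ENNReal.coe_inj]
  rw [this]
  exact isClosed_iInter fun n => isClosed_iInter fun s => isClosed_iInter fun π =>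
    isClosed_eq (continuous_measure_tupleCyl _) (continuous_measure_tupleCyl _)

lemma exchangeable_of_mem_iidParadigm {μ : ProbabilityMeasure Omega} (h : μ ∈ IIDparadigm) :
    Exchangeable (μ : Measure Omega) := by
  obtain ⟨q, hq⟩ := h
  rw [exchangeable_iff]
  intro n s π
  rw [← cyl_ofFn, ← cyl_ofFn, hq, hq, bern_ofFn, bern_ofFn]
  congr 1
  exact (Equiv.prod_comp π fun i => if s i then (q : ℝ) else 1 - (q : ℝ)).symm

lemma Exchangeable.sum_smul {ι : Type*} [Fintype ι] {ν : ι → Measure Omega} (w : ι → ENNReal)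
    (h : ∀ i, Exchangeable (ν i)) : Exchangeable (∑ i, w i • ν i) := by
  intro σ π
  simp only [Measure.coe_finsetSum, Finset.sum_apply, Measure.smul_apply, smul_eq_mul]
  exact Finset.sum_congr rfl fun i _ => by rw [h i σ π]

/-- The law of an i.i.d. sequence of Bernoulli variables with parameter `q`. -/
noncomputable def iidMeasure (q : unitInterval) : ProbabilityMeasure Omega :=
  ⟨Measure.infinitePi fun _ => bernoulliMeasure true false q, inferInstance⟩

lemma iidMeasure_tupleCyl (q : unitInterval) {n : ℕ} (s : Fin n → Bool) :
    (iidMeasure q : Measure Omega) (tupleCyl s) = ENNReal.ofReal (bern (List.ofFn s) q) := by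
  have hs : tupleCyl s = ((Finset.range n : Finset ℕ) : Set ℕ).pi
      fun i => if h : i < n then {s ⟨i, h⟩} else Set.univ := by
    ext x
    simp only [tupleCyl, Set.mem_ofPred_eq, Set.mem_pi, Finset.coe_range, Set.mem_Iio]
    constructor
    · intro h i hi
      simpa [hi] using h ⟨i, hi⟩
    · intro h i
      simpa using h i i.2
  rw [hs, bern_ofFn]
  change Measure.infinitePi (fun _ => bernoulliMeasure true false q) _ = _
  rw [Measure.infinitePi_pi _ fun i _ => MeasurableSet.of_discrete, Finset.prod_range,
    ENNReal.ofReal_prod_of_nonneg]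
  · refine Finset.prod_congr rfl fun i _ => ?_
    rw [← ENNReal.ofReal_toReal (measure_ne_top _ _), ← Measure.real]
    congr 1
    rw [dif_pos i.2]
    cases s i
    · rw [bernoulliMeasure_real_apply_of_notMem_of_mem] <;> simp
    · rw [bernoulliMeasure_real_apply_of_mem_of_notMem] <;> simp
  · intro i _
    split_ifs
    · exact q.2.1
    · linarith [q.2.2]

lemma iidMeasure_mem_iidParadigm (q : unitInterval) : iidMeasure q ∈ IIDparadigm :=
  ⟨q, fun σ => by rw [cyl_eq_tupleCyl, iidMeasure_tupleCyl, List.ofFn_get]⟩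

lemma sum_measureReal_tupleCyl (μ : Measure Omega) [IsProbabilityMeasure μ] {N : ℕ}
    (p : (Fin N → Bool) → Prop) [DecidablePred p] :
    ∑ y, (if p y then μ.real (tupleCyl y) else 0) = μ.real {x | p fun i => x i} := by
  have hset : {x : Omega | p fun i => x i} =
      ⋃ y ∈ Finset.univ.filter p, tupleCyl y := by
    ext x
    simp only [Set.mem_ofPred_eq, Finset.mem_filter, Finset.mem_univ, true_and, Set.mem_iUnion,
      exists_prop]
    refine ⟨fun h => ⟨_, h, fun i => rfl⟩, ?_⟩
    rintro ⟨y, hy, hxy⟩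
    rwa [show (fun i : Fin N => x i) = y from funext hxy]
  rw [hset, measureReal_biUnion_finset, Finset.sum_filter]
  · intro y _ z _ hyz
    refine Set.disjoint_left.2 fun x hxy hxz => hyz (funext fun i => ?_)
    rw [← hxy i, ← hxz i]
  · exact fun y _ => measurableSet_tupleCyl y

lemma exists_perm_castLE_eq {n N : ℕ} (h : n ≤ N) {f : Fin n → Fin N}
    (hf : Function.Injective f) : ∃ π : Equiv.Perm (Fin N), ∀ i, π (Fin.castLE h i) = f i := by
  have hc := Fin.castLE_injective h
  let e := (Equiv.ofInjective _ hc).symm.trans (Equiv.ofInjective f hf)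
  refine ⟨Equiv.extendSubtype e, fun i => ?_⟩
  rw [Equiv.extendSubtype_apply_of_mem e _ ⟨i, rfl⟩]
  simp [e, Equiv.ofInjective_symm_apply hc]

lemma Exchangeable.measureReal_of_injective {μ : Measure Omega} [IsProbabilityMeasure μ]
    (hμ : Exchangeable μ) {n N : ℕ} (s : Fin n → Bool) {f : Fin n → Fin N}
    (hf : Function.Injective f) :
    μ.real {x | ∀ i, x (f i) = s i} = μ.real (tupleCyl s) := by
  have h : n ≤ N := by simpa using Fintype.card_le_of_injective f hf
  obtain ⟨π, hπ⟩ := exists_perm_castLE_eq h hf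
  have h1 := sum_measureReal_tupleCyl μ (N := N) fun y => ∀ i, y (f i) = s i
  have h2 := sum_measureReal_tupleCyl μ (N := N) fun y => ∀ i, y (Fin.castLE h i) = s i
  rw [tupleCyl, ← h1]
  refine Eq.trans ?_ h2
  refine Fintype.sum_equiv (Equiv.arrowCongr π.symm (Equiv.refl Bool)) _ _ fun y => ?_
  have hy : μ.real (tupleCyl y) = μ.real (tupleCyl (y ∘ π)) := by
    rw [Measure.real, (exchangeable_iff μ).1 hμ N y π, Measure.real]
  have hπy : Equiv.arrowCongr π.symm (Equiv.refl Bool) y = y ∘ π := rfl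
  rw [hy, hπy]
  simp [hπ]

/-- The empirical frequency of `true` in a tuple. -/
noncomputable def frequency {N : ℕ} (y : Fin N → Bool) : unitInterval :=
  ⟨(Finset.univ.filter fun j => y j = true).card / N, by positivity,
    div_le_one_of_le₀ (by simpa using Finset.card_filter_le Finset.univ fun j => y j = true)
      (by positivity)⟩

lemma frequency_ite {N : ℕ} (hN : N ≠ 0) (y : Fin N → Bool) (b : Bool) :
    (if b then (frequency y : ℝ) else 1 - frequency y) =
      (N : ℝ)⁻¹ * ∑ j, if y j = b then 1 else 0 := by
  have hN' : (N : ℝ) ≠ 0 := Nat.cast_ne_zero.2 hN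
  have hcard := Finset.card_filter_add_card_filter_not (s := (Finset.univ : Finset (Fin N)))
    fun j => y j = true
  have hcard' : ((Finset.univ.filter fun j => y j = true).card : ℝ) +
      (Finset.univ.filter fun j => y j = false).card = N := by
    simpa using congrArg (Nat.cast : ℕ → ℝ) hcard
  rw [Finset.sum_boole]
  cases b
  · simp only [frequency, Bool.false_eq_true, if_false]
    field_simp
    linarith
  · simp only [frequency, if_true]
    field_simp

lemma bern_frequency {n N : ℕ} (hN : N ≠ 0) (s : Fin n → Bool) (y : Fin N → Bool) :
    bern (List.ofFn s) (frequency y) =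
      ((N : ℝ) ^ n)⁻¹ * ∑ f : Fin n → Fin N, if ∀ i, y (f i) = s i then 1 else 0 := by
  rw [bern_ofFn, Finset.prod_congr rfl fun i _ => frequency_ite hN y (s i),
    Finset.prod_mul_distrib, Finset.prod_univ_sum, Fintype.piFinset_univ]
  simp [Finset.prod_ite_zero]

/-- The mixture of i.i.d. laws, the parameter being distributed as the empirical frequency of the
first `N` coordinates under `μ`. -/
noncomputable def empiricalMixture (μ : ProbabilityMeasure Omega) (N : ℕ) :
    ProbabilityMeasure Omega :=
  ⟨∑ y : Fin N → Bool, (μ : Measure Omega) (tupleCyl y) •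
      (iidMeasure (frequency y) : Measure Omega), ⟨by
    have h := sum_measureReal_tupleCyl (μ : Measure Omega) fun _ : Fin N → Bool => True
    simp only [if_true, Set.ofPred_true, Measure.real] at h
    rw [← ENNReal.toReal_sum fun _ _ => measure_ne_top _ _, measure_univ, ENNReal.toReal_one,
      ENNReal.toReal_eq_one_iff] at h
    simpa using h⟩⟩

lemma empiricalMixture_mem_iidConvexHull (μ : ProbabilityMeasure Omega) (N : ℕ) :
    empiricalMixture μ N ∈ IIDconvexHull := by
  let e := (Fintype.equivFin (Fin N → Bool)).symm
  refine ⟨_, fun i => (μ : Measure Omega) (tupleCyl (e i)), fun i => iidMeasure (frequency (e i)),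
    fun i => iidMeasure_mem_iidParadigm _, ?_, ?_⟩
  · have h : (empiricalMixture μ N : Measure Omega) Set.univ = 1 := measure_univ
    rw [e.sum_comp fun y => (μ : Measure Omega) (tupleCyl y)]
    simpa [empiricalMixture] using h
  · exact (e.sum_comp fun y => (μ : Measure Omega) (tupleCyl y) •
      (iidMeasure (frequency y) : Measure Omega)).symm

lemma empiricalMixture_real_tupleCyl (μ : ProbabilityMeasure Omega) {n N : ℕ} (hN : N ≠ 0)
    (s : Fin n → Bool) :
    (empiricalMixture μ N : Measure Omega).real (tupleCyl s) =
      ((N : ℝ) ^ n)⁻¹ *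
        ∑ f : Fin n → Fin N, (μ : Measure Omega).real {x | ∀ i, x (f i) = s i} := by
  have h1 : (empiricalMixture μ N : Measure Omega).real (tupleCyl s) =
      ∑ y : Fin N → Bool, (μ : Measure Omega).real (tupleCyl y) *
        bern (List.ofFn s) (frequency y) := by
    have : (empiricalMixture μ N : Measure Omega) (tupleCyl s) =
        ∑ y : Fin N → Bool, (μ : Measure Omega) (tupleCyl y) *
          ENNReal.ofReal (bern (List.ofFn s) (frequency y)) := by
      simp [empiricalMixture, iidMeasure_tupleCyl]
    rw [Measure.real, this, ENNReal.toReal_sum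
      fun _ _ => ENNReal.mul_ne_top (measure_ne_top _ _) ENNReal.ofReal_ne_top]
    simp [Measure.real, bern_nonneg]
  rw [h1, Finset.sum_congr rfl fun y _ => by rw [bern_frequency hN s y, mul_left_comm],
    ← Finset.mul_sum]
  congr 1
  simp_rw [Finset.mul_sum]
  rw [Finset.sum_comm]
  refine Finset.sum_congr rfl fun f _ => ?_
  rw [← sum_measureReal_tupleCyl (μ : Measure Omega) fun y => ∀ i, y (f i) = s i]
  simp

lemma card_filter_not_injective (n N : ℕ) :
    ((Finset.univ.filter fun f : Fin n → Fin N => ¬ Function.Injective f).card : ℝ) =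
      N ^ n - N.descFactorial n := by
  have h := Finset.card_filter_add_card_filter_not
    (s := (Finset.univ : Finset (Fin n → Fin N))) Function.Injective
  have hinj : (Finset.univ.filter fun f : Fin n → Fin N => Function.Injective f).card =
      N.descFactorial n := by
    rw [← Fintype.card_subtype,
      Fintype.card_congr (Equiv.subtypeInjectiveEquivEmbedding (Fin n) (Fin N)),
      Fintype.card_embedding_eq, Fintype.card_fin, Fintype.card_fin]
  rw [hinj, Finset.card_univ, Fintype.card_fun, Fintype.card_fin, Fintype.card_fin] at h
  rw [eq_sub_iff_add_eq']
  exact_mod_cast h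

lemma abs_empiricalMixture_sub_le {μ : ProbabilityMeasure Omega}
    (hμ : Exchangeable (μ : Measure Omega)) {n N : ℕ} (hN : N ≠ 0) (s : Fin n → Bool) :
    |(empiricalMixture μ N : Measure Omega).real (tupleCyl s) -
      (μ : Measure Omega).real (tupleCyl s)| ≤ 1 - N.descFactorial n / (N : ℝ) ^ n := by
  have hN' : (0 : ℝ) < (N : ℝ) ^ n := by positivity
  have hconst : (μ : Measure Omega).real (tupleCyl s) = ((N : ℝ) ^ n)⁻¹ *
      ∑ _f : Fin n → Fin N, (μ : Measure Omega).real (tupleCyl s) := by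
    simp [hN'.ne']
  rw [empiricalMixture_real_tupleCyl μ hN s, hconst, ← mul_sub, ← Finset.sum_sub_distrib,
    abs_mul, abs_of_pos (inv_pos.2 hN'), one_sub_div hN'.ne', div_eq_inv_mul]
  gcongr
  rw [← card_filter_not_injective, ← Finset.sum_boole]
  refine (Finset.abs_sum_le_sum_abs _ _).trans (Finset.sum_le_sum fun f _ => ?_)
  split_ifs with hf
  · rw [hμ.measureReal_of_injective s hf, sub_self, abs_zero]
  · exact abs_sub_le_of_nonneg_of_le measureReal_nonneg measureReal_le_one measureReal_nonneg
      measureReal_le_one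

lemma tendsto_empiricalMixture_tupleCyl {μ : ProbabilityMeasure Omega}
    (hμ : Exchangeable (μ : Measure Omega)) {n : ℕ} (s : Fin n → Bool) :
    Tendsto (fun N => empiricalMixture μ N (tupleCyl s)) atTop (𝓝 (μ (tupleCyl s))) := by
  rw [← NNReal.tendsto_coe]
  have hlim : Tendsto (fun N : ℕ => 1 - (N.descFactorial n : ℝ) / (N : ℝ) ^ n) atTop (𝓝 0) := by
    have h := (Asymptotics.isEquivalent_iff_tendsto_one (by
      filter_upwards [eventually_ne_atTop 0] with N hN using by positivity)).1
      (isEquivalent_descFactorial n)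
    simpa using h.const_sub 1
  rw [tendsto_iff_norm_sub_tendsto_zero]
  refine squeeze_zero' (Eventually.of_forall fun _ => norm_nonneg _) ?_ hlim
  filter_upwards [eventually_ne_atTop 0] with N hN
  exact abs_empiricalMixture_sub_le hμ hN s

lemma mem_closure_iidConvexHull {μ : ProbabilityMeasure Omega}
    (hμ : Exchangeable (μ : Measure Omega)) : μ ∈ closure IIDconvexHull := by
  obtain ⟨κ, hκ⟩ := exists_clusterPt_of_compactSpace (map (empiricalMixture μ) atTop)
  have hκμ : κ = μ := probabilityMeasure_ext_of_tupleCyl fun n s => by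
    have h := MapClusterPt.tendsto_comp (continuous_measure_tupleCyl s).continuousAt hκ
    exact eq_of_nhds_neBot (ClusterPt.mono h (tendsto_empiricalMixture_tupleCyl hμ s))
  rw [← hκμ]
  exact isClosed_closure.mem_of_mapClusterPt hκ <|
    Eventually.of_forall fun N => subset_closure (empiricalMixture_mem_iidConvexHull μ N)

/-- The paradigm Γ of exchangeable theories is convex and compact in the weak-* topology,
and equals the closed convex hull of the paradigm of i.i.d. theories. -/
theorem exchangeable_compact_convex_closure_iid :
    IsCompact ExchangeableParadigm ∧
    (∀ μ ∈ ExchangeableParadigm, ∀ ν ∈ ExchangeableParadigm, ∀ a : ENNReal, a ≤ 1 →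
      ∃ κ ∈ ExchangeableParadigm,
        (κ : Measure Omega) = a • (μ : Measure Omega) + (1 - a) • (ν : Measure Omega)) ∧
    ExchangeableParadigm = closure IIDconvexHull := by
  refine ⟨isClosed_exchangeableParadigm.isCompact, fun μ hμ ν hν a ha => ?_, ?_⟩
  · have hprob : IsProbabilityMeasure (a • (μ : Measure Omega) + (1 - a) • (ν : Measure Omega)) :=
      ⟨by simp [add_tsub_cancel_of_le ha]⟩
    refine ⟨⟨_, hprob⟩, fun σ π => ?_, rfl⟩
    change (a • (μ : Measure Omega) + (1 - a) • (ν : Measure Omega)) _ =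
      (a • (μ : Measure Omega) + (1 - a) • (ν : Measure Omega)) _
    simp only [Measure.add_apply, Measure.smul_apply]
    rw [hμ σ π, hν σ π]
  · refine Set.Subset.antisymm (fun μ hμ => mem_closure_iidConvexHull hμ)
      (closure_minimal ?_ isClosed_exchangeableParadigm)
    rintro μ ⟨n, w, ν, hν, -, hμ⟩
    change Exchangeable (μ : Measure Omega)
    rw [hμ]
    exact Exchangeable.sum_smul w fun i => exchangeable_of_mem_iidParadigm (hν i)
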